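/- Let (Λ,d) be a finitely aligned k-graph, E ⊆ Λ finite, and {t_λ : λ ∈ Λ} a Cuntz–Krieger Λ-family. The set {Θ(t,E;λ,μ) : λ,μ ∈ ΠE, d(λ) = d(μ), s(λ) = s(μ)} is a collection of partial isometries which spans M^t_{ΠE} := span{t_λ t_μ* : λ,μ ∈ ΠE, d(λ) = d(μ)} and satisfies the matrix-unit relations: (i) Θ(t,E;λ,μ)* = Θ(t,E;μ,λ); and (ii) Θ(t,E;λ,μ) Θ(t,E;σ,τ) = δ_{μ,σ} Θ(t,E;λ,τ). -/

import Mathlib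

open scoped BigOperators

/-- A `k`-graph: a countable small category (in arrows-only presentation, with objects
identified with the identity morphisms) together with a degree functor into `ℕ^k`
satisfying the factorisation property.  `comp l m` is the composite path `lm`
(first `m`, then `l` in categorical order; range `rng l`, source `src m`), and is
only meaningful when `src l = rng m`. -/
structure KGraph (k : ℕ) where
  Path : Type
  countable : Countable Path
  src : Path → Path
  rng : Path → Path
  comp : Path → Path → Path
  deg : Path → Fin k → ℕ
  deg_src : ∀ l, deg (src l) = 0
  deg_rng : ∀ l, deg (rng l) = 0
  src_eq_of_deg_zero : ∀ v, deg v = 0 → src v = v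
  rng_eq_of_deg_zero : ∀ v, deg v = 0 → rng v = v
  comp_src_self : ∀ l, comp l (src l) = l
  rng_comp_self : ∀ l, comp (rng l) l = l
  src_comp : ∀ l m, src l = rng m → src (comp l m) = src m
  rng_comp : ∀ l m, src l = rng m → rng (comp l m) = rng l
  deg_comp : ∀ l m, src l = rng m → deg (comp l m) = deg l + deg m
  comp_assoc : ∀ l m n, src l = rng m → src m = rng n →
    comp (comp l m) n = comp l (comp m n)
  factorisation : ∀ (l : Path) (m n : Fin k → ℕ), deg l = m + n →
    ∃! p : Path × Path, deg p.1 = m ∧ deg p.2 = n ∧ src p.1 = rng p.2 ∧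
      comp p.1 p.2 = l

namespace KGraph

variable {k : ℕ} (Λ : KGraph k)

/-- The vertices of a `k`-graph are the paths of degree `0`. -/
def IsVertex (v : Λ.Path) : Prop := Λ.deg v = 0

/-- An edge is a path of degree `e_i` for some `i`. -/
def IsEdge (e : Λ.Path) : Prop := ∃ i : Fin k, Λ.deg e = Pi.single i 1

/-- `vΛ`, the set of paths with range `v`. -/
def withRange (v : Λ.Path) : Set Λ.Path := {l | Λ.rng l = v}

/-- `Λ^min(l,m)`, the set of pairs giving minimal common extensions of `l` and `m`. -/
def minExt (l m : Λ.Path) : Set (Λ.Path × Λ.Path) :=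
  {p | Λ.src l = Λ.rng p.1 ∧ Λ.src m = Λ.rng p.2 ∧
    Λ.comp l p.1 = Λ.comp m p.2 ∧ Λ.deg (Λ.comp l p.1) = Λ.deg l ⊔ Λ.deg m}

/-- A `k`-graph is finitely aligned if all the sets `Λ^min(l,m)` are finite. -/
def FinitelyAligned : Prop := ∀ l m, (Λ.minExt l m).Finite

/-- A subset `E ⊆ vΛ` is exhaustive if every path in `vΛ` has a common extension
with some member of `E`. -/
def Exhaustive (v : Λ.Path) (E : Set Λ.Path) : Prop :=
  ∀ m ∈ Λ.withRange v, ∃ l ∈ E, (Λ.minExt l m).Nonempty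

/-- `Λ^{≤ n}`. -/
def degLe (n : Fin k → ℕ) : Set Λ.Path :=
  {l | Λ.deg l ≤ n ∧ ∀ i : Fin k, Λ.deg l i < n i →
    ¬∃ e, Λ.rng e = Λ.src l ∧ Λ.deg e = Pi.single i 1}

end KGraph

open Classical in
/-- The sum of `f` over a set `S`, defined to be `0` if `S` is infinite. -/
noncomputable def setSum {ι A : Type*} [AddCommMonoid A] (S : Set ι) (f : ι → A) : A :=
  if h : S.Finite then ∑ i ∈ h.toFinset, f i else 0

open Classical in
/-- The product of `f` over a set `S` taken in an arbitrary (but fixed) order,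
defined to be `1` if `S` is infinite.  All products appearing below have commuting
factors, for which this is the usual product over a finite set. -/
noncomputable def setProd {ι A : Type*} [Monoid A] (S : Set ι) (f : ι → A) : A :=
  if h : S.Finite then (h.toFinset.toList.map f).prod else 1

namespace KGraph

variable {k : ℕ} (Λ : KGraph k) {A : Type*} [Ring A] [StarRing A]

/-- Relations (CK1)–(CK3) for a family of partial isometries indexed by a `k`-graph. -/
structure IsCK13 (t : Λ.Path → A) : Prop where
  partialIsometry : ∀ l, t l * star (t l) * t l = t l
  vertex_projection : ∀ v, Λ.IsVertex v → star (t v) = t v ∧ t v * t v = t v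
  vertex_orthogonal : ∀ v w, Λ.IsVertex v → Λ.IsVertex w → v ≠ w → t v * t w = 0
  comp_mul : ∀ l m, Λ.src l = Λ.rng m → t l * t m = t (Λ.comp l m)
  ck3 : ∀ l m, star (t l) * t m =
    setSum (Λ.minExt l m) fun p => t p.1 * star (t p.2)

/-- A Cuntz–Krieger `Λ`-family: relations (CK1)–(CK4). -/
structure IsCKFamily (t : Λ.Path → A) extends IsCK13 Λ t : Prop where
  ck4 : ∀ v E, Λ.IsVertex v → E ⊆ Λ.withRange v → E.Finite → Λ.Exhaustive v E →
    setProd E (fun l => t v - t l * star (t l)) = 0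

/-- Condition (†) on a subset `F ⊆ Λ`. -/
def DaggerClosed (F : Set Λ.Path) : Prop :=
  ∀ l m σ τ a b, l ∈ F → m ∈ F → σ ∈ F → τ ∈ F →
    Λ.deg l = Λ.deg m → Λ.deg σ = Λ.deg τ →
    Λ.src l = Λ.src m → Λ.src σ = Λ.src τ →
    (a, b) ∈ Λ.minExt m σ → Λ.comp l a ∈ F ∧ Λ.comp τ b ∈ F

/-- `ΠE`, the smallest subset of `Λ` containing `E` and satisfying (†). -/
def piSet (E : Set Λ.Path) : Set Λ.Path := ⋂₀ {F | E ⊆ F ∧ Λ.DaggerClosed F}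

/-- For `P ⊆ Λ` and a path `l`, the set `{ν ∈ s(l)Λ : d(ν) > 0 and lν ∈ P}`;
with `P = ΠE` this is the set `T(l)`. -/
def extInto (P : Set Λ.Path) (l : Λ.Path) : Set Λ.Path :=
  {ν | Λ.src l = Λ.rng ν ∧ Λ.deg ν ≠ 0 ∧ Λ.comp l ν ∈ P}

/-- The projection `Q(t)^{ΠE}_l`. -/
noncomputable def Qproj (t : Λ.Path → A) (E : Set Λ.Path) (l : Λ.Path) : A :=
  t l * star (t l) *
    setProd (Λ.extInto (Λ.piSet E) l)
      (fun ν => t l * star (t l) - t (Λ.comp l ν) * star (t (Λ.comp l ν)))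

/-- The matrix unit `Θ(t,E;l,m) = Q(t)^{ΠE}_l t_l t_m^*`. -/
noncomputable def Theta (t : Λ.Path → A) (E : Set Λ.Path) (l m : Λ.Path) : A :=
  Λ.Qproj t E l * (t l * star (t m))

end KGraph

/-- A degree-preserving functor `x : Ω_{k,m} → Λ` for some `m ∈ (ℕ ∪ {∞})^k`,
recorded by its degree `m` and its values `map p q` on the morphisms `(p,q)` of
`Ω_{k,m}` (normalised to the junk value `map 0 0` on pairs `(p,q)` that are not
morphisms of `Ω_{k,m}`). -/
structure OmegaMor {k : ℕ} (Λ : KGraph k) where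
  m : Fin k → ℕ∞
  map : (Fin k → ℕ) → (Fin k → ℕ) → Λ.Path
  deg_map : ∀ p q : Fin k → ℕ, p ≤ q → (∀ i, (q i : ℕ∞) ≤ m i) →
    Λ.deg (map p q) = q - p
  rng_map : ∀ p q : Fin k → ℕ, p ≤ q → (∀ i, (q i : ℕ∞) ≤ m i) →
    Λ.rng (map p q) = map p p
  src_map : ∀ p q : Fin k → ℕ, p ≤ q → (∀ i, (q i : ℕ∞) ≤ m i) →
    Λ.src (map p q) = map q q
  comp_map : ∀ p q r : Fin k → ℕ, p ≤ q → q ≤ r → (∀ i, (r i : ℕ∞) ≤ m i) →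
    Λ.comp (map p q) (map q r) = map p r
  map_default : ∀ p q : Fin k → ℕ, ¬(p ≤ q ∧ ∀ i, (q i : ℕ∞) ≤ m i) →
    map p q = map 0 0

/-- `x` is a boundary path: there is `n_x ≤ m` such that whenever `n_x ≤ n ≤ m`
and `n_i = m_i`, the vertex `x(n)` receives no edge of degree `e_i`. -/
def OmegaMor.IsBoundary {k : ℕ} {Λ : KGraph k} (x : OmegaMor Λ) : Prop :=
  ∃ nx : Fin k → ℕ, (∀ i, (nx i : ℕ∞) ≤ x.m i) ∧
    ∀ n : Fin k → ℕ, nx ≤ n → (∀ i, (n i : ℕ∞) ≤ x.m i) →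
      ∀ i : Fin k, (n i : ℕ∞) = x.m i →
        ¬∃ e, Λ.rng e = x.map n n ∧ Λ.deg e = Pi.single i 1


namespace KGraph

section Paths

variable {k : ℕ} {Λ : KGraph k}

lemma rng_src (l : Λ.Path) : Λ.rng (Λ.src l) = Λ.src l :=
  Λ.rng_eq_of_deg_zero _ (Λ.deg_src l)

lemma comp_eq_self_of_deg_eq_zero {l a : Λ.Path} (h : Λ.src l = Λ.rng a) (ha : Λ.deg a = 0) :
    Λ.comp l a = l := by
  have : a = Λ.src l := by rw [h, Λ.rng_eq_of_deg_zero a ha]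
  rw [this, Λ.comp_src_self]

lemma comp_inj {l m a b : Λ.Path} (hl : Λ.src l = Λ.rng a) (hm : Λ.src m = Λ.rng b)
    (hd : Λ.deg l = Λ.deg m) (h : Λ.comp l a = Λ.comp m b) : l = m ∧ a = b := by
  have hab : Λ.deg a = Λ.deg b := by
    have := congrArg Λ.deg h
    rw [Λ.deg_comp _ _ hl, Λ.deg_comp _ _ hm, hd] at this
    exact add_left_cancel this
  have := (Λ.factorisation (Λ.comp m b) (Λ.deg m) (Λ.deg b) (Λ.deg_comp _ _ hm)).unique
    (y₁ := (l, a)) (y₂ := (m, b)) ⟨hd, hab, hl, h⟩ ⟨rfl, rfl, hm, rfl⟩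
  exact Prod.mk.inj this

lemma comp_left_cancel {l a b : Λ.Path} (ha : Λ.src l = Λ.rng a) (hb : Λ.src l = Λ.rng b)
    (h : Λ.comp l a = Λ.comp l b) : a = b :=
  (comp_inj ha hb rfl h).2

/-- If `l a = y c` and `d(l) ≤ d(y)`, then `y` extends `l`. -/
lemma exists_extension {l a y c : Λ.Path} (hl : Λ.src l = Λ.rng a) (hy : Λ.src y = Λ.rng c)
    (h : Λ.comp l a = Λ.comp y c) (hd : Λ.deg l ≤ Λ.deg y) :
    ∃ b, Λ.src l = Λ.rng b ∧ Λ.comp l b = y ∧ Λ.src b = Λ.rng c ∧ a = Λ.comp b c := by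
  obtain ⟨⟨l', b⟩, ⟨h1, h2, h3, h4⟩, -⟩ := Λ.factorisation y (Λ.deg l) (Λ.deg y - Λ.deg l)
    (add_tsub_cancel_of_le hd).symm
  dsimp only at h1 h2 h3 h4
  have hbc : Λ.src b = Λ.rng c := by rw [← hy, ← h4, Λ.src_comp _ _ h3]
  have hr : Λ.rng (Λ.comp b c) = Λ.rng b := Λ.rng_comp _ _ hbc
  have := comp_inj (l := l') (m := l) (a := Λ.comp b c) (b := a) (h3.trans hr.symm) hl h1
    (by rw [h, ← h4, Λ.comp_assoc _ _ _ h3 hbc])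
  obtain ⟨rfl, rfl⟩ := this
  exact ⟨b, h3, h4, hbc, rfl⟩

/-- Every common extension factors through a minimal one. -/
lemma exists_minExt {l m a b : Λ.Path} (hl : Λ.src l = Λ.rng a) (hm : Λ.src m = Λ.rng b)
    (h : Λ.comp l a = Λ.comp m b) :
    ∃ a' b' c, (a', b') ∈ Λ.minExt l m ∧ Λ.src (Λ.comp l a') = Λ.rng c ∧
      Λ.comp (Λ.comp l a') c = Λ.comp l a := by
  have hle : Λ.deg l ⊔ Λ.deg m ≤ Λ.deg (Λ.comp l a) := by
    refine sup_le ?_ ?_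
    · rw [Λ.deg_comp _ _ hl]; exact le_self_add
    · rw [h, Λ.deg_comp _ _ hm]; exact le_self_add
  obtain ⟨⟨y, c⟩, ⟨h1, h2, h3, h4⟩, -⟩ := Λ.factorisation (Λ.comp l a) _ _
    (add_tsub_cancel_of_le hle).symm
  dsimp only at h1 h2 h3 h4
  obtain ⟨a', ha', hya, -⟩ := exists_extension hl h3 h4.symm (h1 ▸ le_sup_left)
  obtain ⟨b', hb', hyb, -⟩ := exists_extension hm h3 (h.symm.trans h4.symm) (h1 ▸ le_sup_right)
  exact ⟨a', b', c, ⟨ha', hb', hya.trans hyb.symm, by rw [hya, h1]⟩, by rw [hya, h3],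
    by rw [hya, h4]⟩

lemma minExt_swap {l m a b : Λ.Path} (h : (a, b) ∈ Λ.minExt l m) : (b, a) ∈ Λ.minExt m l := by
  obtain ⟨h1, h2, h3, h4⟩ := h
  exact ⟨h2, h1, h3.symm, by dsimp only at *; rw [← h3, h4, sup_comm]⟩

lemma minExt_self (l : Λ.Path) : Λ.minExt l l = {(Λ.src l, Λ.src l)} := by
  ext ⟨a, b⟩
  constructor
  · rintro ⟨h1, h2, h3, h4⟩
    dsimp only at h1 h2 h3 h4
    obtain rfl := comp_left_cancel h1 h2 h3
    rw [Λ.deg_comp _ _ h1, sup_idem, add_eq_left] at h4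
    rw [← Λ.rng_eq_of_deg_zero a h4, ← h1]
    rfl
  · rintro h
    obtain ⟨rfl, rfl⟩ := Prod.mk.inj h
    exact ⟨(rng_src l).symm, (rng_src l).symm, rfl, by simp [Λ.comp_src_self]⟩

variable {E P : Set Λ.Path}

lemma DaggerClosed.comp_mem_of_minExt (hP : Λ.DaggerClosed P) {l m a b : Λ.Path} (hl : l ∈ P)
    (hm : m ∈ P) (h : (a, b) ∈ Λ.minExt l m) : Λ.comp l a ∈ P :=
  (hP l l m m a b hl hl hm hm rfl rfl rfl rfl h).1

lemma DaggerClosed.comp_mem_of_comp_mem (hP : Λ.DaggerClosed P) {l m a : Λ.Path} (hl : l ∈ P)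
    (hm : m ∈ P) (hd : Λ.deg l = Λ.deg m) (hs : Λ.src l = Λ.src m) (ha : Λ.src m = Λ.rng a)
    (h : Λ.comp m a ∈ P) : Λ.comp l a ∈ P := by
  refine (hP l m _ _ a (Λ.src (Λ.comp m a)) hl hm h h hd rfl hs rfl
    ⟨ha, (rng_src _).symm, (Λ.comp_src_self _).symm, ?_⟩).1
  dsimp only
  rw [eq_comm, sup_eq_right, Λ.deg_comp _ _ ha]
  exact le_self_add

lemma subset_piSet (E : Set Λ.Path) : E ⊆ Λ.piSet E :=
  Set.subset_sInter fun _ hF => hF.1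

lemma piSet_subset (h : E ⊆ P) (hP : Λ.DaggerClosed P) : Λ.piSet E ⊆ P :=
  Set.sInter_subset_of_mem ⟨h, hP⟩

lemma daggerClosed_piSet (E : Set Λ.Path) : Λ.DaggerClosed (Λ.piSet E) := by
  intro l m σ τ a b hl hm hσ hτ h1 h2 h3 h4 h
  have key : ∀ F, E ⊆ F ∧ Λ.DaggerClosed F → Λ.comp l a ∈ F ∧ Λ.comp τ b ∈ F := fun F hF =>
    hF.2 l m σ τ a b (hl F hF) (hm F hF) (hσ F hF) (hτ F hF) h1 h2 h3 h4 h
  exact ⟨fun F hF => (key F hF).1, fun F hF => (key F hF).2⟩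

lemma deg_comp_of_minExt {l m σ a b : Λ.Path} (hd : Λ.deg l = Λ.deg m) (hs : Λ.src l = Λ.src m)
    (h : (a, b) ∈ Λ.minExt m σ) : Λ.deg (Λ.comp l a) = Λ.deg m ⊔ Λ.deg σ := by
  obtain ⟨h1, h2, h3, h4⟩ := h
  dsimp only at *
  rw [← h4, Λ.deg_comp _ _ h1, Λ.deg_comp _ _ (hs.trans h1), hd]

/-- One half of (†) suffices, by symmetry. -/
lemma daggerClosed_of_left
    (h : ∀ l m σ a b, l ∈ P → m ∈ P → σ ∈ P → Λ.deg l = Λ.deg m → Λ.src l = Λ.src m →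
      (a, b) ∈ Λ.minExt m σ → Λ.comp l a ∈ P) : Λ.DaggerClosed P :=
  fun l m σ τ a b hl hm hσ hτ h1 h2 h3 h4 hab =>
    ⟨h l m σ a b hl hm hσ h1 h3 hab,
      h τ σ m b a hτ hσ hm h2.symm h4.symm (minExt_swap hab)⟩

lemma finite_setOf_comp_mem {S : Set Λ.Path} (hS : S.Finite) (l : Λ.Path) :
    {a | Λ.src l = Λ.rng a ∧ Λ.comp l a ∈ S}.Finite :=
  Set.Finite.of_finite_image (f := Λ.comp l)
    (hS.subset (by rintro _ ⟨a, ha, rfl⟩; exact ha.2))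
    fun _ ha _ hb h => comp_left_cancel ha.1 hb.1 h

/-- `l` is an initial segment of `x`. -/
def IsPrefix (l x : Λ.Path) : Prop := ∃ a, Λ.src l = Λ.rng a ∧ Λ.comp l a = x

/-- `l` is an initial segment of `x` in `L`, of the largest degree among these. -/
def IsTop (L : Set Λ.Path) (l x : Λ.Path) : Prop :=
  l ∈ L ∧ IsPrefix l x ∧ ∀ m ∈ L, IsPrefix m x → Λ.deg m ≤ Λ.deg l

/-- The paths in `P` of degree less than `n`. -/
def degLt (P : Set Λ.Path) (n : Fin k → ℕ) : Set Λ.Path := {x | x ∈ P ∧ Λ.deg x < n}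

/-- The paths obtained from `L` by a single application of (†), together with `E`. -/
def daggerStep (E L : Set Λ.Path) : Set Λ.Path :=
  E ∪ {x | ∃ l ∈ L, ∃ m ∈ L, ∃ σ ∈ L, ∃ p ∈ Λ.minExt m σ, Λ.comp l p.1 = x}

/-- The tails left after removing an initial segment in `L` from a member of `S`. -/
def tails (L S : Set Λ.Path) : Set Λ.Path :=
  {a | ∃ l ∈ L, Λ.src l = Λ.rng a ∧ Λ.comp l a ∈ S}

/-- A set containing all the paths of a given degree in `ΠE` when `L` consists of those of
smaller degree. -/
def daggerBound (E L : Set Λ.Path) : Set Λ.Path :=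
  daggerStep E L ∪ {x | ∃ l a, IsTop L l x ∧ Λ.src l = Λ.rng a ∧ Λ.comp l a = x ∧
    a ∈ tails L (daggerStep E L)}

lemma finite_daggerStep (hΛ : Λ.FinitelyAligned) {L : Set Λ.Path} (hE : E.Finite)
    (hL : L.Finite) : (daggerStep E L).Finite := by
  refine hE.union ?_
  have : {x | ∃ l ∈ L, ∃ m ∈ L, ∃ σ ∈ L, ∃ p ∈ Λ.minExt m σ, Λ.comp l p.1 = x} =
      ⋃ l ∈ L, ⋃ m ∈ L, ⋃ σ ∈ L, (fun p => Λ.comp l p.1) '' Λ.minExt m σ := by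
    ext x; simp
  rw [this]
  exact hL.biUnion fun l _ => hL.biUnion fun m _ => hL.biUnion fun σ _ => (hΛ m σ).image _

lemma finite_daggerBound (hΛ : Λ.FinitelyAligned) {L : Set Λ.Path} (hE : E.Finite)
    (hL : L.Finite) : (daggerBound E L).Finite := by
  have hS := finite_daggerStep hΛ hE hL
  have hT : (tails L (daggerStep E L)).Finite := by
    have : tails L (daggerStep E L) =
        ⋃ l ∈ L, {a | Λ.src l = Λ.rng a ∧ Λ.comp l a ∈ daggerStep E L} := by
      ext x; simp only [tails, Set.mem_iUnion, Set.mem_ofPred_eq, exists_prop]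
    rw [this]
    exact hL.biUnion fun l _ => finite_setOf_comp_mem hS l
  refine hS.union ((Set.Finite.image2 Λ.comp hL hT).subset ?_)
  rintro x ⟨l, a, hl, -, rfl, ha⟩
  exact ⟨l, hl.1, a, ha, rfl⟩

lemma exists_isTop (hP : Λ.DaggerClosed P) {n : Fin k → ℕ} (hL : (degLt P n).Finite)
    {x l : Λ.Path} (hx : Λ.deg x = n) (hxS : x ∉ daggerStep E (degLt P n))
    (hl : l ∈ degLt P n) (hlx : IsPrefix l x) : ∃ ν, IsTop (degLt P n) ν x := by
  obtain ⟨ν, ⟨hν, hνx⟩, hmax⟩ := Set.exists_max_image {μ | μ ∈ degLt P n ∧ IsPrefix μ x}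
    (fun μ => ∑ i, Λ.deg μ i) (hL.subset fun _ h => h.1) ⟨l, hl, hlx⟩
  refine ⟨ν, hν, hνx, fun μ hμ hμx => ?_⟩
  obtain ⟨a, ha, rfl⟩ := hμx
  obtain ⟨b, hb, hab⟩ := hνx
  obtain ⟨a', b', c, hmin, hc, hc'⟩ := exists_minExt ha hb hab.symm
  have hyP : Λ.comp μ a' ∈ P := hP.comp_mem_of_minExt hμ.1 hν.1 hmin
  have hyd : Λ.deg (Λ.comp μ a') = Λ.deg μ ⊔ Λ.deg ν := hmin.2.2.2
  have hyn : Λ.deg (Λ.comp μ a') < n := by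
    refine lt_of_le_of_ne ?_ fun h => hxS ?_
    · rw [← hx, ← hc', Λ.deg_comp _ _ hc]; exact le_self_add
    · have hc0 : Λ.deg c = 0 := by
        rw [← hc', Λ.deg_comp _ _ hc, h, add_eq_left] at hx
        exact hx
      rw [← hc', comp_eq_self_of_deg_eq_zero hc hc0]
      exact Or.inr ⟨μ, hμ, μ, hμ, ν, hν, _, hmin, rfl⟩
  have hle := hmax _ ⟨⟨hyP, hyn⟩, c, hc, hc'⟩
  have hge : Λ.deg ν ≤ Λ.deg (Λ.comp μ a') := hyd ▸ le_sup_right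
  have heq : Λ.deg ν = Λ.deg (Λ.comp μ a') := by
    funext i
    exact (Finset.sum_eq_sum_iff_of_le fun i _ => hge i).1
      (le_antisymm (Finset.sum_le_sum fun i _ => hge i) hle) i (Finset.mem_univ i)
  rw [heq, hyd]
  exact le_sup_left

/-- Replacing an initial segment preserves membership in the bounding set. -/
lemma comp_mem_daggerBound (hP : Λ.DaggerClosed P) {n : Fin k → ℕ} (hL : (degLt P n).Finite)
    {l m a : Λ.Path} (hl : l ∈ degLt P n) (hm : m ∈ degLt P n) (hd : Λ.deg l = Λ.deg m)
    (hs : Λ.src l = Λ.src m) (ha : Λ.src m = Λ.rng a) (hn : Λ.deg (Λ.comp m a) = n)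
    (hma : Λ.comp m a ∈ daggerBound E (degLt P n)) :
    Λ.comp l a ∈ daggerBound E (degLt P n) := by
  have hla : Λ.src l = Λ.rng a := hs.trans ha
  by_cases hS : Λ.comp l a ∈ daggerStep E (degLt P n)
  · exact Or.inl hS
  have hn' : Λ.deg (Λ.comp l a) = n := by rw [← hn, Λ.deg_comp _ _ hla, Λ.deg_comp _ _ ha, hd]
  obtain ⟨ν, hν⟩ := exists_isTop hP hL hn' hS hl ⟨a, hla, rfl⟩
  obtain ⟨c, hc, hcx⟩ := hν.2.1
  obtain ⟨b, hb, hlb, hbc, rfl⟩ :=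
    exists_extension hla hc hcx.symm (hν.2.2 l hl ⟨a, hla, rfl⟩)
  have hmb : Λ.src m = Λ.rng b := hs ▸ hb
  have hmbc : Λ.src (Λ.comp m b) = Λ.rng c := by rw [Λ.src_comp _ _ hmb, hbc]
  have hmbP : Λ.comp m b ∈ degLt P n := by
    refine ⟨hP.comp_mem_of_comp_mem hm.1 hl.1 hd.symm hs.symm hb (hlb ▸ hν.1.1), ?_⟩
    have := hν.1.2
    rwa [← hlb, Λ.deg_comp _ _ hb, hd, ← Λ.deg_comp _ _ hmb] at this
  rw [← Λ.comp_assoc _ _ _ hmb hbc] at hma hn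
  refine Or.inr ⟨ν, c, hν, hc, hcx, ?_⟩
  rcases hma with hma | ⟨μ, d, hμ, hd', hμd, hdT⟩
  · exact ⟨_, hmbP, hmbc, hma⟩
  obtain ⟨g, hg, hmg, hgd, rfl⟩ :=
    exists_extension hmbc hd' hμd.symm (hμ.2.2 _ hmbP ⟨c, hmbc, rfl⟩)
  have hbg : Λ.src b = Λ.rng g := by rw [hbc, Λ.rng_comp _ _ hgd]
  have hνg : Λ.src ν = Λ.rng g := by rw [hc, Λ.rng_comp _ _ hgd]
  have hνgP : Λ.comp ν g ∈ degLt P n := by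
    have hdν : Λ.deg ν = Λ.deg (Λ.comp m b) := by
      rw [← hlb, Λ.deg_comp _ _ hb, hd, Λ.deg_comp _ _ hmb]
    refine ⟨hP.comp_mem_of_comp_mem hν.1.1 hmbP.1 hdν (hc.trans hmbc.symm) hg
      (hmg ▸ hμ.1.1), ?_⟩
    have := hμ.1.2
    rwa [← hmg, Λ.deg_comp _ _ hg, ← hdν, ← Λ.deg_comp _ _ hνg] at this
  have hνgd : Λ.src (Λ.comp ν g) = Λ.rng d := by rw [Λ.src_comp _ _ hνg, hgd]
  have hle := hν.2.2 _ hνgP ⟨d, hνgd, by rw [Λ.comp_assoc _ _ _ hνg hgd, hcx]⟩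
  have hg0 : Λ.deg g = 0 := by
    rw [Λ.deg_comp _ _ hνg] at hle
    exact le_antisymm (le_of_add_le_add_left (hle.trans_eq (add_zero _).symm)) zero_le
  have hgr : g = Λ.rng d := by rw [← hgd, Λ.src_eq_of_deg_zero g hg0]
  rwa [hgr, Λ.rng_comp_self]

lemma piSet_deg_subset_daggerBound {n : Fin k → ℕ} (hL : (degLt (Λ.piSet E) n).Finite) :
    {x | x ∈ Λ.piSet E ∧ Λ.deg x = n} ⊆ daggerBound E (degLt (Λ.piSet E) n) := by
  set L := degLt (Λ.piSet E) n with hLdef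
  have hP := daggerClosed_piSet E
  have key : Λ.piSet E ⊆ {x | x ∈ Λ.piSet E ∧ (Λ.deg x = n → x ∈ daggerBound E L)} := by
    refine piSet_subset (fun x hx => ⟨subset_piSet E hx, fun _ => Or.inl (Or.inl hx)⟩)
      (daggerClosed_of_left ?_)
    rintro l m σ a b ⟨hl, hln⟩ ⟨hm, -⟩ ⟨hσ, hσn⟩ hd hs hab
    refine ⟨(hP l m σ σ a b hl hm hσ hσ hd rfl hs rfl hab).1, fun hn => ?_⟩
    have hjoin := deg_comp_of_minExt hd hs hab
    rw [hn] at hjoin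
    obtain ⟨h1, h2, h3, h4⟩ := hab
    dsimp only at h1 h2 h3 h4
    rcases (hjoin ▸ le_sup_left : Λ.deg m ≤ n).eq_or_lt with hmn | hmn
    · have ha0 : Λ.deg a = 0 := by
        rwa [Λ.deg_comp _ _ (hs.trans h1), hd, hmn, add_eq_left] at hn
      rw [comp_eq_self_of_deg_eq_zero (hs.trans h1) ha0]
      exact hln (hd.trans hmn)
    have hmL : m ∈ L := ⟨hm, hmn⟩
    have hlL : l ∈ L := ⟨hl, hd ▸ hmn⟩
    rcases (hjoin ▸ le_sup_right : Λ.deg σ ≤ n).eq_or_lt with hσ' | hσ'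
    · have hb0 : Λ.deg b = 0 := by
        rwa [h3, Λ.deg_comp _ _ h2, ← hjoin, hσ', add_eq_left] at h4
      rw [comp_eq_self_of_deg_eq_zero h2 hb0] at h3
      exact comp_mem_daggerBound hP hL hlL hmL hd hs h1 (h3 ▸ hσ') (h3 ▸ hσn hσ')
    · exact Or.inl (Or.inr ⟨l, hlL, m, hmL, σ, ⟨hσ, hσ'⟩, (a, b), ⟨h1, h2, h3, h4⟩, rfl⟩)
  exact fun x hx => (key hx.1).2 hx.2

lemma exists_deg_le_piSet (hE : E.Finite) : ∃ N, ∀ x ∈ Λ.piSet E, Λ.deg x ≤ N := by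
  refine ⟨hE.toFinset.sup Λ.deg, fun x hx =>
    piSet_subset (P := {x | Λ.deg x ≤ hE.toFinset.sup Λ.deg}) ?_ (daggerClosed_of_left ?_) hx⟩
  · intro y hy
    rw [Set.mem_ofPred_eq]
    exact Finset.le_sup (hE.mem_toFinset.2 hy)
  · intro l m σ a b _ hm hσ hd hs hab
    rw [Set.mem_ofPred_eq, deg_comp_of_minExt hd hs hab]
    exact sup_le hm hσ

lemma finite_piSet (hΛ : Λ.FinitelyAligned) (hE : E.Finite) : (Λ.piSet E).Finite := by
  have hfin : ∀ n : Fin k → ℕ, {x | x ∈ Λ.piSet E ∧ Λ.deg x = n}.Finite := by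
    intro n
    induction n using WellFoundedLT.induction with
    | ind n ih =>
      have hL : (degLt (Λ.piSet E) n).Finite := by
        refine ((Set.finite_Iio n).biUnion fun m hm => ih m hm).subset fun x hx => ?_
        exact Set.mem_biUnion (Set.mem_Iio.2 hx.2) ⟨hx.1, rfl⟩
      exact (finite_daggerBound hΛ hE hL).subset (piSet_deg_subset_daggerBound hL)
  obtain ⟨N, hN⟩ := exists_deg_le_piSet (Λ := Λ) hE
  refine ((Set.finite_Iic N).biUnion fun m _ => hfin m).subset fun x hx => ?_
  exact Set.mem_biUnion (Set.mem_Iic.2 (hN x hx)) ⟨hx, rfl⟩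

end Paths

end KGraph

section ListProd

variable {ι A : Type*}

lemma exists_list_setProd_eq [Monoid A] {S : Set ι} (hS : S.Finite) :
    ∃ L : List ι, (∀ i, i ∈ L ↔ i ∈ S) ∧ ∀ f : ι → A, setProd S f = (L.map f).prod :=
  ⟨hS.toFinset.toList, fun i => by simp, fun f => by rw [setProd, dif_pos hS]⟩

lemma setSum_eq_sum [AddCommMonoid A] {S : Set ι} (hS : S.Finite) (f : ι → A) :
    setSum S f = ∑ i ∈ hS.toFinset, f i := dif_pos hS

lemma commute_list_map_prod [Monoid A] {f : ι → A} (hf : ∀ i j, Commute (f i) (f j)) (i : ι)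
    (L : List ι) : Commute (f i) (L.map f).prod :=
  Commute.list_prod_right _ _ fun x hx => by
    obtain ⟨j, -, rfl⟩ := List.mem_map.1 hx
    exact hf i j

lemma star_list_map_prod [Monoid A] [StarMul A] {f : ι → A} (hf : ∀ i j, Commute (f i) (f j))
    (hs : ∀ i, star (f i) = f i) (L : List ι) : star (L.map f).prod = (L.map f).prod := by
  induction L with
  | nil => simp
  | cons a L ih =>
    rw [List.map_cons, List.prod_cons, star_mul, ih, hs, (commute_list_map_prod hf a L).eq]

lemma list_map_prod_mul_self [Monoid A] {f : ι → A} (hf : ∀ i j, Commute (f i) (f j))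
    (hs : ∀ i, f i * f i = f i) (L : List ι) :
    (L.map f).prod * (L.map f).prod = (L.map f).prod := by
  induction L with
  | nil => simp
  | cons a L ih =>
    rw [List.map_cons, List.prod_cons, (commute_list_map_prod hf a L).symm.mul_mul_mul_comm, hs, ih]

lemma list_map_prod_mul_of_mem [Monoid A] {f : ι → A} (hf : ∀ i j, Commute (f i) (f j))
    (hs : ∀ i, f i * f i = f i) {L : List ι} {a : ι} (ha : a ∈ L) :
    (L.map f).prod * f a = (L.map f).prod := by
  induction L with
  | nil => simp at ha
  | cons b L ih =>
    rw [List.map_cons, List.prod_cons]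
    rcases List.mem_cons.1 ha with rfl | ha
    · rw [(commute_list_map_prod hf a L).eq, mul_assoc, hs]
    · rw [mul_assoc, ih ha]

lemma mul_list_prod_mem {R : Type*} [CommSemiring R] [Semiring A] [Algebra R A]
    {M : Submodule R A} (hM : M * M ≤ M) {a : A} (ha : a ∈ M) {L : List A}
    (hL : ∀ x ∈ L, x ∈ M) : a * L.prod ∈ M := by
  induction L generalizing a with
  | nil => simpa
  | cons b L ih =>
    rw [List.prod_cons, ← mul_assoc]
    exact ih (hM (Submodule.mul_mem_mul ha (hL b List.mem_cons_self)))
      fun x hx => hL x (List.mem_cons_of_mem b hx)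

lemma one_sub_list_prod_mem {R : Type*} [CommRing R] [Ring A] [Algebra R A]
    {M : Submodule R A} (hM : M * M ≤ M) {f : ι → A} {L : List ι}
    (hL : ∀ i ∈ L, f i ∈ M) : 1 - (L.map fun i => 1 - f i).prod ∈ M := by
  induction L with
  | nil => simp
  | cons b L ih =>
    have ih := ih fun x hx => hL x (List.mem_cons_of_mem b hx)
    have hb := hL b List.mem_cons_self
    rw [List.map_cons, List.prod_cons]
    convert M.sub_mem (M.add_mem ih hb) (hM (Submodule.mul_mem_mul hb ih)) using 1
    noncomm_ring

end ListProd

namespace KGraph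

section Relations

variable {k : ℕ} {Λ : KGraph k} {A : Type*} [Ring A] [StarRing A] {t : Λ.Path → A}

namespace IsCK13

lemma mul_src (ht : Λ.IsCK13 t) (l : Λ.Path) : t l * t (Λ.src l) = t l := by
  rw [ht.comp_mul _ _ (rng_src l).symm, Λ.comp_src_self]

lemma star_src (ht : Λ.IsCK13 t) (l : Λ.Path) : star (t (Λ.src l)) = t (Λ.src l) :=
  (ht.vertex_projection _ (Λ.deg_src l)).1

lemma src_mul_star (ht : Λ.IsCK13 t) (l : Λ.Path) : t (Λ.src l) * star (t l) = star (t l) := by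
  rw [← ht.star_src, ← star_mul, ht.mul_src]

lemma src_mul (ht : Λ.IsCK13 t) {l a : Λ.Path} (h : Λ.src l = Λ.rng a) :
    t (Λ.src l) * t a = t a := by
  have h' : Λ.src (Λ.src l) = Λ.rng a := by rw [Λ.src_eq_of_deg_zero _ (Λ.deg_src l), h]
  rw [ht.comp_mul _ _ h', h, Λ.rng_comp_self]

lemma star_mul_src (ht : Λ.IsCK13 t) {l a : Λ.Path} (h : Λ.src l = Λ.rng a) :
    star (t a) * t (Λ.src l) = star (t a) := by
  rw [← ht.star_src, ← star_mul, ht.src_mul h]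

lemma star_mul_self (ht : Λ.IsCK13 t) (l : Λ.Path) : star (t l) * t l = t (Λ.src l) := by
  have hs : (Λ.minExt l l).Finite := by rw [minExt_self]; exact Set.finite_singleton _
  have : hs.toFinset = {(Λ.src l, Λ.src l)} := by
    ext p; rw [hs.mem_toFinset, minExt_self]; simp
  rw [ht.ck3, setSum_eq_sum hs, this, Finset.sum_singleton, ht.star_src,
    (ht.vertex_projection _ (Λ.deg_src l)).2]

lemma mul_star_eq_zero (ht : Λ.IsCK13 t) {l m : Λ.Path} (h : Λ.src l ≠ Λ.src m) :
    t l * star (t m) = 0 := by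
  rw [← ht.mul_src l, ← ht.src_mul_star m, mul_assoc, ← mul_assoc (t (Λ.src l)),
    ht.vertex_orthogonal _ _ (Λ.deg_src l) (Λ.deg_src m) h, zero_mul, mul_zero]

lemma star_mul_eq_sum (ht : Λ.IsCK13 t) (hΛ : Λ.FinitelyAligned) (l m : Λ.Path) :
    star (t l) * t m = ∑ p ∈ (hΛ l m).toFinset, t p.1 * star (t p.2) := by
  rw [ht.ck3, setSum_eq_sum (hΛ l m)]

lemma mul_star_mul_mul_star (ht : Λ.IsCK13 t) (hΛ : Λ.FinitelyAligned) {l m σ τ : Λ.Path}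
    (hl : Λ.src l = Λ.src m) (hσ : Λ.src σ = Λ.src τ) :
    t l * star (t m) * (t σ * star (t τ)) =
      ∑ p ∈ (hΛ m σ).toFinset, t (Λ.comp l p.1) * star (t (Λ.comp τ p.2)) := by
  rw [mul_assoc, ← mul_assoc (star (t m)), ht.star_mul_eq_sum hΛ, Finset.sum_mul,
    Finset.mul_sum]
  refine Finset.sum_congr rfl fun p hp => ?_
  obtain ⟨h1, h2, -, -⟩ := (hΛ m σ).mem_toFinset.1 hp
  rw [← ht.comp_mul _ _ (hl.trans h1), ← ht.comp_mul _ _ (hσ.symm.trans h2), star_mul]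
  simp only [mul_assoc]

lemma mul_star_commute (ht : Λ.IsCK13 t) (hΛ : Λ.FinitelyAligned) (l m : Λ.Path) :
    Commute (t l * star (t l)) (t m * star (t m)) := by
  have h := ht.mul_star_mul_mul_star hΛ (l := l) (σ := m) rfl rfl
  have hs : star (t l * star (t l) * (t m * star (t m))) =
      t l * star (t l) * (t m * star (t m)) := by
    rw [h, star_sum]
    refine Finset.sum_congr rfl fun p hp => ?_
    obtain ⟨-, -, h3, -⟩ := (hΛ l m).mem_toFinset.1 hp
    rw [star_mul, star_star, h3]
  rw [Commute, SemiconjBy, ← hs]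
  simp only [star_mul, star_star]

lemma one_sub_commute (ht : Λ.IsCK13 t) (hΛ : Λ.FinitelyAligned) (l m : Λ.Path) :
    Commute (1 - t l * star (t l)) (1 - t m * star (t m)) :=
  ((Commute.one_left _).sub_left
    ((Commute.one_right _).sub_right (ht.mul_star_commute hΛ l m)))

lemma one_sub_mul (ht : Λ.IsCK13 t) (l : Λ.Path) : (1 - t l * star (t l)) * t l = 0 := by
  rw [sub_mul, one_mul, ht.partialIsometry, sub_self]

lemma one_sub_mul_self (ht : Λ.IsCK13 t) (l : Λ.Path) :
    (1 - t l * star (t l)) * (1 - t l * star (t l)) = 1 - t l * star (t l) := by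
  rw [mul_sub, mul_one, ← mul_assoc, ht.one_sub_mul, zero_mul, sub_zero]

lemma star_one_sub (l : Λ.Path) : star (1 - t l * star (t l)) = 1 - t l * star (t l) := by
  simp

lemma list_prod_mul_eq_zero (ht : Λ.IsCK13 t) (hΛ : Λ.FinitelyAligned) {L : List Λ.Path}
    {a : Λ.Path} (ha : a ∈ L) : (L.map fun ν => 1 - t ν * star (t ν)).prod * t a = 0 := by
  rw [← list_map_prod_mul_of_mem (f := fun ν => 1 - t ν * star (t ν)) (ht.one_sub_commute hΛ)
    ht.one_sub_mul_self ha, mul_assoc, ht.one_sub_mul, mul_zero]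

lemma star_mul_list_prod_eq_zero (ht : Λ.IsCK13 t) (hΛ : Λ.FinitelyAligned) {L : List Λ.Path}
    {a : Λ.Path} (ha : a ∈ L) :
    star (t a) * (L.map fun ν => 1 - t ν * star (t ν)).prod = 0 := by
  have h := congrArg star (ht.list_prod_mul_eq_zero hΛ ha)
  rwa [star_mul, star_list_map_prod (f := fun ν => 1 - t ν * star (t ν))
    (ht.one_sub_commute hΛ) star_one_sub, star_zero] at h

lemma list_prod_mul (ht : Λ.IsCK13 t) {l : Λ.Path} {L : List Λ.Path}
    (hL : ∀ ν ∈ L, Λ.src l = Λ.rng ν) :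
    (L.map fun ν => t l * star (t l) - t (Λ.comp l ν) * star (t (Λ.comp l ν))).prod * t l =
      t l * (L.map fun ν => 1 - t ν * star (t ν)).prod := by
  induction L with
  | nil => simp
  | cons a L ih =>
    have ha := hL a List.mem_cons_self
    have h : t (Λ.comp l a) * star (t (Λ.comp l a)) * t l = t l * (t a * star (t a)) := by
      rw [← ht.comp_mul _ _ ha, star_mul]
      simp only [mul_assoc]
      rw [ht.star_mul_self, ht.star_mul_src ha]
    rw [List.map_cons, List.map_cons, List.prod_cons, List.prod_cons, mul_assoc,
      ih fun x hx => hL x (List.mem_cons_of_mem a hx), ← mul_assoc, ← mul_assoc, sub_mul, h,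
      ht.partialIsometry, mul_sub, mul_one]

end IsCK13

variable {E P : Set Λ.Path}

lemma DaggerClosed.extInto_eq (hP : Λ.DaggerClosed P) {l m : Λ.Path} (hl : l ∈ P)
    (hm : m ∈ P) (hd : Λ.deg l = Λ.deg m) (hs : Λ.src l = Λ.src m) :
    Λ.extInto P l = Λ.extInto P m := by
  ext ν
  exact ⟨fun ⟨h1, h2, h3⟩ => ⟨hs ▸ h1, h2, hP.comp_mem_of_comp_mem hm hl hd.symm hs.symm h1 h3⟩,
    fun ⟨h1, h2, h3⟩ => ⟨hs ▸ h1, h2, hP.comp_mem_of_comp_mem hl hm hd hs h1 h3⟩⟩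

lemma finite_extInto (hP : P.Finite) (l : Λ.Path) : (Λ.extInto P l).Finite :=
  (finite_setOf_comp_mem hP l).subset fun _ h => ⟨h.1, h.2.2⟩

/-- The projection `∏ (1 - t_ν t_ν^*)` over `ν ∈ T(l)`. -/
noncomputable def gapProj (t : Λ.Path → A) (E : Set Λ.Path) (l : Λ.Path) : A :=
  setProd (Λ.extInto (Λ.piSet E) l) fun ν => 1 - t ν * star (t ν)

lemma gapProj_congr {l m : Λ.Path} (hl : l ∈ Λ.piSet E) (hm : m ∈ Λ.piSet E)
    (hd : Λ.deg l = Λ.deg m) (hs : Λ.src l = Λ.src m) : gapProj t E l = gapProj t E m := by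
  rw [gapProj, gapProj, (daggerClosed_piSet E).extInto_eq hl hm hd hs]

namespace IsCK13

lemma star_gapProj (ht : Λ.IsCK13 t) (hΛ : Λ.FinitelyAligned) (hE : E.Finite) (l : Λ.Path) :
    star (gapProj t E l) = gapProj t E l := by
  obtain ⟨L, -, hL⟩ := exists_list_setProd_eq (A := A) (finite_extInto (finite_piSet hΛ hE) l)
  rw [gapProj, hL]
  exact star_list_map_prod (ht.one_sub_commute hΛ) star_one_sub L

lemma gapProj_mul_self (ht : Λ.IsCK13 t) (hΛ : Λ.FinitelyAligned) (hE : E.Finite)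
    (l : Λ.Path) : gapProj t E l * gapProj t E l = gapProj t E l := by
  obtain ⟨L, -, hL⟩ := exists_list_setProd_eq (A := A) (finite_extInto (finite_piSet hΛ hE) l)
  rw [gapProj, hL]
  exact list_map_prod_mul_self (ht.one_sub_commute hΛ) ht.one_sub_mul_self L

lemma gapProj_mul_eq_zero (ht : Λ.IsCK13 t) (hΛ : Λ.FinitelyAligned) (hE : E.Finite)
    {l a : Λ.Path} (ha : a ∈ Λ.extInto (Λ.piSet E) l) : gapProj t E l * t a = 0 := by
  obtain ⟨L, hmem, hL⟩ :=
    exists_list_setProd_eq (A := A) (finite_extInto (finite_piSet hΛ hE) l)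
  rw [gapProj, hL]
  exact ht.list_prod_mul_eq_zero hΛ ((hmem a).2 ha)

lemma star_mul_gapProj_eq_zero (ht : Λ.IsCK13 t) (hΛ : Λ.FinitelyAligned) (hE : E.Finite)
    {l a : Λ.Path} (ha : a ∈ Λ.extInto (Λ.piSet E) l) : star (t a) * gapProj t E l = 0 := by
  rw [← ht.star_gapProj hΛ hE, ← star_mul, ht.gapProj_mul_eq_zero hΛ hE ha, star_zero]

lemma src_commute_gapProj (ht : Λ.IsCK13 t) (hΛ : Λ.FinitelyAligned) (hE : E.Finite)
    (l : Λ.Path) : Commute (t (Λ.src l)) (gapProj t E l) := by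
  obtain ⟨L, -, hL⟩ := exists_list_setProd_eq (A := A) (finite_extInto (finite_piSet hΛ hE) l)
  rw [gapProj, hL]
  refine Commute.list_prod_right _ _ fun x hx => ?_
  obtain ⟨ν, -, rfl⟩ := List.mem_map.1 hx
  have h := ht.mul_star_commute hΛ (Λ.src l) ν
  rw [ht.star_src, (ht.vertex_projection _ (Λ.deg_src l)).2] at h
  exact (Commute.one_right _).sub_right h

lemma Theta_eq (ht : Λ.IsCK13 t) (hΛ : Λ.FinitelyAligned) (hE : E.Finite) (l m : Λ.Path) :
    Λ.Theta t E l m = t l * gapProj t E l * star (t m) := by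
  obtain ⟨L, hmem, hL⟩ :=
    exists_list_setProd_eq (A := A) (finite_extInto (finite_piSet hΛ hE) l)
  rw [Theta, Qproj, gapProj, hL, hL, ← mul_assoc, mul_assoc (t l * star (t l)),
    ht.list_prod_mul fun ν hν => ((hmem ν).1 hν).1, ← mul_assoc (t l * star (t l)),
    ht.partialIsometry]

lemma star_Theta (ht : Λ.IsCK13 t) (hΛ : Λ.FinitelyAligned) (hE : E.Finite) {l m : Λ.Path}
    (hl : l ∈ Λ.piSet E) (hm : m ∈ Λ.piSet E) (hd : Λ.deg l = Λ.deg m)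
    (hs : Λ.src l = Λ.src m) : star (Λ.Theta t E l m) = Λ.Theta t E m l := by
  rw [ht.Theta_eq hΛ hE, ht.Theta_eq hΛ hE, star_mul, star_mul, star_star,
    ht.star_gapProj hΛ hE, gapProj_congr hl hm hd hs, mul_assoc]

lemma gapProj_mul_star_mul_gapProj (ht : Λ.IsCK13 t) (hΛ : Λ.FinitelyAligned) (hE : E.Finite)
    {m σ : Λ.Path} (hm : m ∈ Λ.piSet E) (hσ : σ ∈ Λ.piSet E) (h : m ≠ σ) :
    gapProj t E m * (star (t m) * t σ) * gapProj t E σ = 0 := by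
  rw [ht.star_mul_eq_sum hΛ, Finset.mul_sum, Finset.sum_mul]
  refine Finset.sum_eq_zero fun ⟨a, b⟩ hp => ?_
  rw [(hΛ m σ).mem_toFinset] at hp
  have hmem := (daggerClosed_piSet E).comp_mem_of_minExt hm hσ hp
  obtain ⟨h1, h2, h3, -⟩ := hp
  dsimp only at h1 h2 h3 ⊢
  by_cases ha : Λ.deg a = 0
  · by_cases hb : Λ.deg b = 0
    · rw [comp_eq_self_of_deg_eq_zero h1 ha, comp_eq_self_of_deg_eq_zero h2 hb] at h3
      exact absurd h3 h
    · rw [mul_assoc, mul_assoc, ht.star_mul_gapProj_eq_zero hΛ hE ⟨h2, hb, h3 ▸ hmem⟩,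
        mul_zero, mul_zero]
  · rw [← mul_assoc, ht.gapProj_mul_eq_zero hΛ hE ⟨h1, ha, hmem⟩, zero_mul, zero_mul]

lemma Theta_mul_Theta_of_ne (ht : Λ.IsCK13 t) (hΛ : Λ.FinitelyAligned) (hE : E.Finite)
    {l m σ τ : Λ.Path} (hl : l ∈ Λ.piSet E) (hm : m ∈ Λ.piSet E) (hσ : σ ∈ Λ.piSet E)
    (hd : Λ.deg l = Λ.deg m) (hs : Λ.src l = Λ.src m) (h : m ≠ σ) :
    Λ.Theta t E l m * Λ.Theta t E σ τ = 0 := by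
  have h0 := ht.gapProj_mul_star_mul_gapProj hΛ hE hm hσ h
  calc Λ.Theta t E l m * Λ.Theta t E σ τ
      = t l * (gapProj t E m * (star (t m) * t σ) * gapProj t E σ) * star (t τ) := by
        rw [ht.Theta_eq hΛ hE, ht.Theta_eq hΛ hE, gapProj_congr hl hm hd hs]
        simp only [mul_assoc]
    _ = 0 := by rw [h0, mul_zero, zero_mul]

lemma Theta_mul_Theta (ht : Λ.IsCK13 t) (hΛ : Λ.FinitelyAligned) (hE : E.Finite)
    {l m τ : Λ.Path} (hl : l ∈ Λ.piSet E) (hm : m ∈ Λ.piSet E)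
    (hd : Λ.deg l = Λ.deg m) (hs : Λ.src l = Λ.src m) :
    Λ.Theta t E l m * Λ.Theta t E m τ = Λ.Theta t E l τ := by
  calc Λ.Theta t E l m * Λ.Theta t E m τ
      = t l * (gapProj t E m * (star (t m) * t m) * gapProj t E m) * star (t τ) := by
        rw [ht.Theta_eq hΛ hE, ht.Theta_eq hΛ hE, gapProj_congr hl hm hd hs]
        simp only [mul_assoc]
    _ = t l * t (Λ.src l) * (gapProj t E m * gapProj t E m) * star (t τ) := by
        rw [ht.star_mul_self, ← (ht.src_commute_gapProj hΛ hE m).eq, hs]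
        simp only [mul_assoc]
    _ = Λ.Theta t E l τ := by
        rw [ht.mul_src, ht.gapProj_mul_self hΛ hE, ht.Theta_eq hΛ hE,
          gapProj_congr hl hm hd hs]

end IsCK13

end Relations

section Span

variable {k : ℕ} {Λ : KGraph k} {R A : Type*} [CommRing R] [Ring A] [StarRing A] [Algebra R A]
  {t : Λ.Path → A} {E : Set Λ.Path}

namespace IsCK13

lemma span_mul_span_le (ht : Λ.IsCK13 t) (hΛ : Λ.FinitelyAligned) {P : Set Λ.Path}
    (hP : Λ.DaggerClosed P) :
    Submodule.span R {a : A | ∃ l ∈ P, ∃ m ∈ P, Λ.deg l = Λ.deg m ∧ a = t l * star (t m)} *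
        Submodule.span R {a : A | ∃ l ∈ P, ∃ m ∈ P, Λ.deg l = Λ.deg m ∧ a = t l * star (t m)} ≤
      Submodule.span R
        {a : A | ∃ l ∈ P, ∃ m ∈ P, Λ.deg l = Λ.deg m ∧ a = t l * star (t m)} := by
  rw [Submodule.span_mul_span, Submodule.span_le]
  rintro _ ⟨_, ⟨l, hl, m, hm, hd, rfl⟩, _, ⟨σ, hσ, τ, hτ, hd', rfl⟩, rfl⟩
  dsimp only
  rw [SetLike.mem_coe]
  by_cases hs : Λ.src l = Λ.src m
  swap
  · rw [ht.mul_star_eq_zero hs, zero_mul]; exact Submodule.zero_mem _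
  by_cases hs' : Λ.src σ = Λ.src τ
  swap
  · rw [ht.mul_star_eq_zero hs', mul_zero]; exact Submodule.zero_mem _
  rw [ht.mul_star_mul_mul_star hΛ hs hs']
  refine Submodule.sum_mem _ fun ⟨a, b⟩ hp => Submodule.subset_span ?_
  rw [(hΛ m σ).mem_toFinset] at hp
  have hmem := hP l m σ τ a b hl hm hσ hτ hd hd' hs hs' hp
  refine ⟨_, hmem.1, _, hmem.2, ?_, rfl⟩
  rw [deg_comp_of_minExt hd hs hp, deg_comp_of_minExt hd'.symm hs'.symm (minExt_swap hp),
    sup_comm]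

lemma Theta_mem_span (ht : Λ.IsCK13 t) (hΛ : Λ.FinitelyAligned) (hE : E.Finite)
    {l m : Λ.Path} (hl : l ∈ Λ.piSet E) (hm : m ∈ Λ.piSet E) (hd : Λ.deg l = Λ.deg m) :
    Λ.Theta t E l m ∈ Submodule.span R {a : A | ∃ l ∈ Λ.piSet E, ∃ m ∈ Λ.piSet E,
      Λ.deg l = Λ.deg m ∧ a = t l * star (t m)} := by
  have hM := ht.span_mul_span_le (R := R) hΛ (daggerClosed_piSet E)
  have hmem : ∀ l ∈ Λ.piSet E, t l * star (t l) ∈ Submodule.span R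
      {a : A | ∃ l ∈ Λ.piSet E, ∃ m ∈ Λ.piSet E, Λ.deg l = Λ.deg m ∧ a = t l * star (t m)} :=
    fun l hl => Submodule.subset_span ⟨l, hl, l, hl, rfl, rfl⟩
  obtain ⟨L, hL, hprod⟩ :=
    exists_list_setProd_eq (A := A) (finite_extInto (finite_piSet hΛ hE) l)
  rw [Theta, Qproj, hprod]
  refine hM (Submodule.mul_mem_mul (mul_list_prod_mem hM (hmem l hl) fun x hx => ?_)
    (Submodule.subset_span ⟨l, hl, m, hm, hd, rfl⟩))
  obtain ⟨ν, hν, rfl⟩ := List.mem_map.1 hx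
  exact Submodule.sub_mem _ (hmem l hl) (hmem _ ((hL ν).1 hν).2.2)

lemma span_extInto_mul_le (ht : Λ.IsCK13 t) (hΛ : Λ.FinitelyAligned) {P : Set Λ.Path}
    (hP : Λ.DaggerClosed P) (l : Λ.Path) :
    Submodule.span R ((fun ν => t ν * star (t ν)) '' Λ.extInto P l) *
        Submodule.span R ((fun ν => t ν * star (t ν)) '' Λ.extInto P l) ≤
      Submodule.span R ((fun ν => t ν * star (t ν)) '' Λ.extInto P l) := by
  rw [Submodule.span_mul_span, Submodule.span_le]
  rintro _ ⟨_, ⟨μ, hμ, rfl⟩, _, ⟨ν, hν, rfl⟩, rfl⟩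
  dsimp only
  rw [SetLike.mem_coe, ht.mul_star_mul_mul_star hΛ rfl rfl]
  refine Submodule.sum_mem _ fun ⟨a, b⟩ hp => Submodule.subset_span ?_
  rw [(hΛ μ ν).mem_toFinset] at hp
  obtain ⟨h1, h2, h3, h4⟩ := hp
  dsimp only at h1 h2 h3 h4 ⊢
  have hla : Λ.src l = Λ.rng (Λ.comp μ a) := by rw [Λ.rng_comp _ _ h1, hμ.1]
  refine ⟨Λ.comp μ a, ⟨hla, fun h => hμ.2.1 ?_, ?_⟩, by rw [h3]⟩
  · rw [h4] at h
    exact le_antisymm (h ▸ le_sup_left) zero_le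
  · rw [← Λ.comp_assoc _ _ _ hμ.1 h1]
    refine hP.comp_mem_of_minExt hμ.2.2 hν.2.2 (b := b) ⟨?_, ?_, ?_, ?_⟩
    · rw [Λ.src_comp _ _ hμ.1, h1]
    · rw [Λ.src_comp _ _ hν.1, h2]
    · dsimp only
      rw [Λ.comp_assoc _ _ _ hμ.1 h1, Λ.comp_assoc _ _ _ hν.1 h2, h3]
    · dsimp only
      rw [Λ.comp_assoc _ _ _ hμ.1 h1, Λ.deg_comp _ _ hla, h4, Λ.deg_comp _ _ hμ.1,
        Λ.deg_comp _ _ hν.1]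
      funext i
      simp

lemma one_sub_gapProj_mem (ht : Λ.IsCK13 t) (hΛ : Λ.FinitelyAligned) (hE : E.Finite)
    (l : Λ.Path) : 1 - gapProj t E l ∈
      Submodule.span R ((fun ν => t ν * star (t ν)) '' Λ.extInto (Λ.piSet E) l) := by
  obtain ⟨L, hL, hprod⟩ :=
    exists_list_setProd_eq (A := A) (finite_extInto (finite_piSet hΛ hE) l)
  rw [gapProj, hprod]
  exact one_sub_list_prod_mem (ht.span_extInto_mul_le hΛ (daggerClosed_piSet E) l)
    fun ν hν => Submodule.subset_span ⟨ν, (hL ν).1 hν, rfl⟩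

lemma mul_star_mem_span_Theta (ht : Λ.IsCK13 t) (hΛ : Λ.FinitelyAligned) (hE : E.Finite)
    {l m : Λ.Path} (hl : l ∈ Λ.piSet E) (hm : m ∈ Λ.piSet E) (hd : Λ.deg l = Λ.deg m)
    (hs : Λ.src l = Λ.src m) :
    t l * star (t m) ∈ Submodule.span R {a : A | ∃ l ∈ Λ.piSet E, ∃ m ∈ Λ.piSet E,
      Λ.deg l = Λ.deg m ∧ Λ.src l = Λ.src m ∧ a = Λ.Theta t E l m} := by
  obtain ⟨N, hN⟩ := exists_deg_le_piSet (Λ := Λ) hE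
  induction hc : (∑ i, N i) - ∑ i, Λ.deg l i using Nat.strong_induction_on generalizing l m with
  | _ c ih =>
    set V := Submodule.span R {a : A | ∃ l ∈ Λ.piSet E, ∃ m ∈ Λ.piSet E,
      Λ.deg l = Λ.deg m ∧ Λ.src l = Λ.src m ∧ a = Λ.Theta t E l m} with hV
    have hext : Submodule.span R ((fun ν => t ν * star (t ν)) '' Λ.extInto (Λ.piSet E) l) ≤
        V.comap ((LinearMap.mulRight R (star (t m))).comp (LinearMap.mulLeft R (t l))) := by
      rw [Submodule.span_le]
      rintro _ ⟨ν, ⟨h1, h2, h3⟩, rfl⟩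
      have h1' := hs.symm.trans h1
      have hmν := (daggerClosed_piSet E).comp_mem_of_comp_mem hm hl hd.symm hs.symm h1 h3
      have hval : t l * (t ν * star (t ν)) * star (t m) =
          t (Λ.comp l ν) * star (t (Λ.comp m ν)) := by
        rw [← ht.comp_mul _ _ h1, ← ht.comp_mul _ _ h1', star_mul]
        simp only [mul_assoc]
      simp only [SetLike.mem_coe, Submodule.mem_comap, LinearMap.comp_apply,
        LinearMap.mulLeft_apply, LinearMap.mulRight_apply, hval]
      refine ih _ ?_ h3 hmν ?_ ?_ rfl
      · have hlt : ∑ i, Λ.deg l i < ∑ i, Λ.deg (Λ.comp l ν) i := by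
          rw [Λ.deg_comp _ _ h1]
          simp only [Pi.add_apply, Finset.sum_add_distrib]
          refine Nat.lt_add_of_pos_right (Nat.pos_of_ne_zero fun h0 => h2 ?_)
          funext i
          exact Finset.sum_eq_zero_iff.1 h0 i (Finset.mem_univ i)
        have hle : ∑ i, Λ.deg (Λ.comp l ν) i ≤ ∑ i, N i :=
          Finset.sum_le_sum fun i _ => hN _ h3 i
        omega
      · rw [Λ.deg_comp _ _ h1, Λ.deg_comp _ _ h1', hd]
      · rw [Λ.src_comp _ _ h1, Λ.src_comp _ _ h1']
    have h1 := hext (ht.one_sub_gapProj_mem hΛ hE l)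
    simp only [Submodule.mem_comap, LinearMap.comp_apply, LinearMap.mulLeft_apply,
      LinearMap.mulRight_apply, mul_sub, sub_mul, mul_one, ← ht.Theta_eq hΛ hE] at h1
    have h2 : Λ.Theta t E l m ∈ V := Submodule.subset_span ⟨l, hl, m, hm, hd, hs, rfl⟩
    simpa using V.add_mem h1 h2

end IsCK13

end Span

end KGraph

open Classical in
/-- the `Θ(t,E;l,m)` are partial isometries spanning `M^t_{ΠE}` and
satisfying the matrix-unit relations. -/
theorem stmt11 {k : ℕ} (Λ : KGraph k) (hΛ : Λ.FinitelyAligned)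
    (E : Set Λ.Path) (hE : E.Finite) {A : Type*} [CStarAlgebra A]
    (t : Λ.Path → A) (ht : Λ.IsCKFamily t) :
    (∀ l ∈ Λ.piSet E, ∀ m ∈ Λ.piSet E,
      Λ.deg l = Λ.deg m → Λ.src l = Λ.src m →
      Λ.Theta t E l m * star (Λ.Theta t E l m) * Λ.Theta t E l m = Λ.Theta t E l m) ∧
    Submodule.span ℂ
        {a : A | ∃ l ∈ Λ.piSet E, ∃ m ∈ Λ.piSet E,
          Λ.deg l = Λ.deg m ∧ Λ.src l = Λ.src m ∧ a = Λ.Theta t E l m} =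
      Submodule.span ℂ
        {a : A | ∃ l ∈ Λ.piSet E, ∃ m ∈ Λ.piSet E,
          Λ.deg l = Λ.deg m ∧ a = t l * star (t m)} ∧
    (∀ l ∈ Λ.piSet E, ∀ m ∈ Λ.piSet E,
      Λ.deg l = Λ.deg m → Λ.src l = Λ.src m →
      star (Λ.Theta t E l m) = Λ.Theta t E m l) ∧
    (∀ l ∈ Λ.piSet E, ∀ m ∈ Λ.piSet E, ∀ σ ∈ Λ.piSet E, ∀ τ ∈ Λ.piSet E,
      Λ.deg l = Λ.deg m → Λ.src l = Λ.src m →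
      Λ.deg σ = Λ.deg τ → Λ.src σ = Λ.src τ →
      Λ.Theta t E l m * Λ.Theta t E σ τ =
        if m = σ then Λ.Theta t E l τ else 0) := by
  have ht' := ht.toIsCK13
  refine ⟨fun l hl m hm hd hs => ?_, le_antisymm ?_ ?_,
    fun l hl m hm hd hs => ht'.star_Theta hΛ hE hl hm hd hs,
    fun l hl m hm σ hσ τ _ hd hs _ _ => ?_⟩
  · rw [ht'.star_Theta hΛ hE hl hm hd hs, ht'.Theta_mul_Theta hΛ hE hl hm hd hs,
      ht'.Theta_mul_Theta hΛ hE hl hl rfl rfl]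
  · rw [Submodule.span_le]
    rintro _ ⟨l, hl, m, hm, hd, -, rfl⟩
    exact ht'.Theta_mem_span hΛ hE hl hm hd
  · rw [Submodule.span_le]
    rintro _ ⟨l, hl, m, hm, hd, rfl⟩
    by_cases hs : Λ.src l = Λ.src m
    · exact ht'.mul_star_mem_span_Theta hΛ hE hl hm hd hs
    · rw [ht'.mul_star_eq_zero hs]
      exact Submodule.zero_mem _
  · split_ifs with h
    · subst h
      exact ht'.Theta_mul_Theta hΛ hE hl hm hd hs
    · exact ht'.Theta_mul_Theta_of_ne hΛ hE hl hm hσ hd hs h
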